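/- Let μ(dx) = e^{−V(x)} dx on ℝⁿ with V ∈ C². If μ satisfies the Poincaré inequality with constant C_P and V is κ-semi-convex (i.e., ∇²V ≥ −κ·Id with κ ≥ 0), then for every smooth compactly supported f: ∫ ‖∇²f‖_F² dμ ≤ (1 + κ C_P) ∫ (L_μ f)² dμ, where L_μ f = Δf − ⟨∇f, ∇V⟩ and ‖·‖_F is the Frobenius norm. -/

import Mathlib

open MeasureTheory RealInnerProductSpace

/-- Second partial derivative `∂_i ∂_j f (x)` in the coordinate directions of
`EuclideanSpace ℝ (Fin n)`. -/
noncomputable def secondDeriv {n : ℕ} (f : EuclideanSpace ℝ (Fin n) → ℝ)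
    (i j : Fin n) (x : EuclideanSpace ℝ (Fin n)) : ℝ :=
  fderiv ℝ (fun y => fderiv ℝ f y (EuclideanSpace.single j 1)) x
    (EuclideanSpace.single i 1)

/-- The operator `L_μ f = Δ f - ⟨∇f, ∇V⟩` associated to the potential `V`. -/
noncomputable def Lmu {n : ℕ} (V f : EuclideanSpace ℝ (Fin n) → ℝ)
    (x : EuclideanSpace ℝ (Fin n)) : ℝ :=
  (∑ i, secondDeriv f i i x) - ⟪gradient f x, gradient V x⟫

/-- Squared Frobenius norm of the Hessian of `f` at `x`. -/
noncomputable def hessFrobSq {n : ℕ} (f : EuclideanSpace ℝ (Fin n) → ℝ)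
    (x : EuclideanSpace ℝ (Fin n)) : ℝ :=
  ∑ i, ∑ j, (secondDeriv f i j x) ^ 2

section PartialDerivatives

variable {n : ℕ} {f g V : EuclideanSpace ℝ (Fin n) → ℝ}

/-- The partial derivative `∂_i f (x)`. -/
noncomputable def partialDeriv (i : Fin n) (f : EuclideanSpace ℝ (Fin n) → ℝ)
    (x : EuclideanSpace ℝ (Fin n)) : ℝ :=
  fderiv ℝ f x (EuclideanSpace.single i 1)

theorem ContDiff.partialDeriv {k m : WithTop ℕ∞} (hf : ContDiff ℝ k f) (hm : m + 1 ≤ k)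
    (i : Fin n) : ContDiff ℝ m (partialDeriv i f) :=
  (hf.fderiv_right hm).clm_apply contDiff_const

theorem HasCompactSupport.partialDeriv (hf : HasCompactSupport f) (i : Fin n) :
    HasCompactSupport (partialDeriv i f) :=
  hf.fderiv_apply (𝕜 := ℝ) _

theorem partialDeriv_mul (hf : Differentiable ℝ f) (hg : Differentiable ℝ g) (i : Fin n)
    (x : EuclideanSpace ℝ (Fin n)) :
    partialDeriv i (fun y => f y * g y) x
      = partialDeriv i f x * g x + f x * partialDeriv i g x := by
  simp only [partialDeriv]
  rw [fderiv_fun_mul (hf x) (hg x)]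
  simp
  ring

theorem partialDeriv_sub (hf : Differentiable ℝ f) (hg : Differentiable ℝ g) (i : Fin n)
    (x : EuclideanSpace ℝ (Fin n)) :
    partialDeriv i (fun y => f y - g y) x = partialDeriv i f x - partialDeriv i g x := by
  simp only [partialDeriv]
  rw [fderiv_fun_sub (hf x) (hg x)]
  simp

theorem partialDeriv_sum {ι : Type*} {s : Finset ι} {F : ι → EuclideanSpace ℝ (Fin n) → ℝ}
    (hF : ∀ j, Differentiable ℝ (F j)) (i : Fin n) (x : EuclideanSpace ℝ (Fin n)) :
    partialDeriv i (fun y => ∑ j ∈ s, F j y) x = ∑ j ∈ s, partialDeriv i (F j) x := by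
  simp only [partialDeriv]
  rw [fderiv_fun_sum fun j _ => hF j x]
  simp

theorem partialDeriv_comm (hf : ContDiff ℝ 2 f) (i j : Fin n) :
    partialDeriv i (partialDeriv j f) = partialDeriv j (partialDeriv i f) := by
  have hd : Differentiable ℝ (fderiv ℝ f) :=
    (hf.fderiv_right (m := 1) (by norm_num)).differentiable (by norm_num)
  have key (a b : Fin n) (x : EuclideanSpace ℝ (Fin n)) : partialDeriv a (partialDeriv b f) x
      = fderiv ℝ (fderiv ℝ f) x (EuclideanSpace.single a 1) (EuclideanSpace.single b 1) := by
    unfold partialDeriv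
    rw [fderiv_clm_apply (hd x) (differentiableAt_const _)]
    simp
  funext x
  rw [key, key]
  exact (hf.contDiffAt.isSymmSndFDerivAt (by simp)).eq _ _

theorem HasCompactSupport.fun_sum {X ι : Type*} [TopologicalSpace X] (s : Finset ι)
    {F : ι → X → ℝ} (hF : ∀ j, HasCompactSupport (F j)) :
    HasCompactSupport fun x => ∑ j ∈ s, F j x := by
  simpa only [Finset.sum_fn] using HasCompactSupport.finset_sum (s := s) fun j _ => hF j

theorem HasCompactSupport.fun_sq {X : Type*} [TopologicalSpace X] {F : X → ℝ}
    (hF : HasCompactSupport F) : HasCompactSupport fun x => F x ^ 2 :=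
  hF.comp_left (g := fun y => y ^ 2) (by norm_num)

theorem gradient_apply (f : EuclideanSpace ℝ (Fin n) → ℝ) (x : EuclideanSpace ℝ (Fin n))
    (i : Fin n) : gradient f x i = partialDeriv i f x := by
  have h : ⟪gradient f x, EuclideanSpace.single i (1 : ℝ)⟫ = partialDeriv i f x := by
    rw [← InnerProductSpace.toDual_apply_apply, toDual_gradient, partialDeriv]
  rwa [EuclideanSpace.inner_single_right, one_mul, conj_trivial] at h

theorem norm_gradient_sq (f : EuclideanSpace ℝ (Fin n) → ℝ) (x : EuclideanSpace ℝ (Fin n)) :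
    ‖gradient f x‖ ^ 2 = ∑ i, partialDeriv i f x ^ 2 := by
  simp [EuclideanSpace.norm_sq_eq, gradient_apply]

theorem Lmu_eq_sum (V f : EuclideanSpace ℝ (Fin n) → ℝ) (x : EuclideanSpace ℝ (Fin n)) :
    Lmu V f x = ∑ i, (partialDeriv i (partialDeriv i f) x
      - partialDeriv i f x * partialDeriv i V x) := by
  simp only [Lmu, PiLp.inner_apply, gradient_apply, Finset.sum_sub_distrib]
  simp only [RCLike.inner_apply, conj_trivial, mul_comm (partialDeriv _ V x)]
  rfl

theorem inner_fderiv_gradient (hV : ContDiff ℝ 2 V) (x v : EuclideanSpace ℝ (Fin n)) :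
    ⟪fderiv ℝ (gradient V) x v, v⟫
      = ∑ i, ∑ j, v i * v j * partialDeriv i (partialDeriv j V) x := by
  have hg : DifferentiableAt ℝ (gradient V) x := by
    have : Differentiable ℝ (fderiv ℝ V) :=
      (hV.fderiv_right (m := 1) (by norm_num)).differentiable (by norm_num)
    exact (InnerProductSpace.toDual ℝ _).symm.toContinuousLinearEquiv.differentiableAt.comp x
      (this x)
  have hcoord (i j : Fin n) : fderiv ℝ (gradient V) x (EuclideanSpace.single i 1) j
      = partialDeriv i (partialDeriv j V) x := by
    have h := ((EuclideanSpace.proj (𝕜 := ℝ) j).hasFDerivAt.comp x hg.hasFDerivAt).fderiv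
    have h' : (EuclideanSpace.proj (𝕜 := ℝ) j) ∘ gradient V = partialDeriv j V := by
      funext y
      exact gradient_apply V y j
    rw [h'] at h
    rw [partialDeriv, h]
    rfl
  have hv : v = ∑ i, v i • EuclideanSpace.single i (1 : ℝ) := by
    simpa using ((EuclideanSpace.basisFun (Fin n) ℝ).sum_repr v).symm
  have hsum : fderiv ℝ (gradient V) x v
      = ∑ i, v i • fderiv ℝ (gradient V) x (EuclideanSpace.single i 1) := by
    conv_lhs => rw [hv]
    simp
  rw [hsum, sum_inner]
  refine Finset.sum_congr rfl fun i _ => ?_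
  rw [inner_smul_left, PiLp.inner_apply, Finset.mul_sum]
  refine Finset.sum_congr rfl fun j _ => ?_
  rw [hcoord]
  simp
  ring

theorem contDiff_Lmu (hV : ContDiff ℝ 2 V) (hf : ContDiff ℝ 3 f) : ContDiff ℝ 1 (Lmu V f) := by
  rw [funext (Lmu_eq_sum V f)]
  refine ContDiff.sum fun i _ => ContDiff.sub ?_ (ContDiff.mul ?_ ?_)
  · exact (hf.partialDeriv (m := 2) (by norm_num) i).partialDeriv (by norm_num) i
  · exact hf.partialDeriv (by norm_num) i
  · exact hV.partialDeriv (by norm_num) i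

theorem HasCompactSupport.Lmu (hf : HasCompactSupport f) (V : EuclideanSpace ℝ (Fin n) → ℝ) :
    HasCompactSupport (Lmu V f) := by
  rw [funext (Lmu_eq_sum V f)]
  exact HasCompactSupport.fun_sum _ fun i =>
    ((hf.partialDeriv i).partialDeriv i).sub ((hf.partialDeriv i).mul_right)

/-- The commutation relation `∂_i L_μ f = L_μ ∂_i f - ⟨∇f, ∇∂_i V⟩`. -/
theorem partialDeriv_Lmu (hV : ContDiff ℝ 2 V) (hf : ContDiff ℝ 3 f) (i : Fin n)
    (x : EuclideanSpace ℝ (Fin n)) :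
    partialDeriv i (Lmu V f) x = Lmu V (partialDeriv i f) x
      - ∑ j, partialDeriv j f x * partialDeriv i (partialDeriv j V) x := by
  have hf2 : ContDiff ℝ 2 f := hf.of_le (by norm_num)
  have h1 (j : Fin n) : ContDiff ℝ 2 (partialDeriv j f) := hf.partialDeriv (by norm_num) j
  have h2 (j : Fin n) : Differentiable ℝ (partialDeriv j (partialDeriv j f)) :=
    ((h1 j).partialDeriv (m := 1) (by norm_num) j).differentiable (by norm_num)
  have h3 (j : Fin n) : Differentiable ℝ (partialDeriv j f) := (h1 j).differentiable (by norm_num)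
  have h4 (j : Fin n) : Differentiable ℝ (partialDeriv j V) :=
    (hV.partialDeriv (m := 1) (by norm_num) j).differentiable (by norm_num)
  have hd (j : Fin n) : Differentiable ℝ fun y => partialDeriv j (partialDeriv j f) y
      - partialDeriv j f y * partialDeriv j V y := (h2 j).sub ((h3 j).mul (h4 j))
  rw [funext (Lmu_eq_sum V f), partialDeriv_sum hd,
    Lmu_eq_sum, ← Finset.sum_sub_distrib]
  refine Finset.sum_congr rfl fun j _ => ?_
  rw [partialDeriv_sub (h2 j) ((h3 j).fun_mul (h4 j)), partialDeriv_mul (h3 j) (h4 j),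
    partialDeriv_comm (h1 j) i j, partialDeriv_comm hf2 i j]
  ring

end PartialDerivatives

section WeightedIntegrals

variable {n : ℕ} {f g V : EuclideanSpace ℝ (Fin n) → ℝ} {μ : Measure (EuclideanSpace ℝ (Fin n))}

/-- Integration against the measure with density `exp (-V)`. -/
theorem integral_withDensity_exp_neg (hV : Continuous V)
    (hμ : μ = volume.withDensity (fun x => ENNReal.ofReal (Real.exp (-V x))))
    (g : EuclideanSpace ℝ (Fin n) → ℝ) : ∫ x, g x ∂μ = ∫ x, g x * Real.exp (-V x) := by
  rw [hμ, integral_withDensity_eq_integral_toReal_smul (by fun_prop) (by simp)]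
  simp [ENNReal.toReal_ofReal (Real.exp_pos _).le, mul_comm]

theorem isOpenPosMeasure_withDensity_exp_neg (hV : Continuous V)
    (hμ : μ = volume.withDensity (fun x => ENNReal.ofReal (Real.exp (-V x)))) :
    μ.IsOpenPosMeasure := by
  have h : (volume : Measure (EuclideanSpace ℝ (Fin n))) ≪ μ := by
    rw [hμ]
    refine withDensity_absolutelyContinuous' (by fun_prop) (.of_forall fun x => ?_)
    simp [Real.exp_pos]
  exact h.isOpenPosMeasure

theorem integral_partialDeriv_eq (hV : ContDiff ℝ 1 V)
    (hμ : μ = volume.withDensity (fun x => ENNReal.ofReal (Real.exp (-V x))))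
    (hf : ContDiff ℝ 1 f) (hfc : HasCompactSupport f) (i : Fin n) :
    ∫ x, partialDeriv i f x ∂μ = ∫ x, f x * partialDeriv i V x ∂μ := by
  have hVd : Differentiable ℝ V := hV.differentiable (by norm_num)
  have hexp (x : EuclideanSpace ℝ (Fin n)) :
      fderiv ℝ (fun y => Real.exp (-V y)) x (EuclideanSpace.single i 1)
        = -(partialDeriv i V x * Real.exp (-V x)) := by
    rw [fderiv_exp (hVd x).fun_neg, fderiv_fun_neg]
    simp [partialDeriv, mul_comm]
  have cV : Continuous (partialDeriv i V) :=
    (hV.partialDeriv (m := 0) (by norm_num) i).continuous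
  have cf : Continuous (partialDeriv i f) :=
    (hf.partialDeriv (m := 0) (by norm_num) i).continuous
  have cV0 := hV.continuous
  have cf0 := hf.continuous
  have key := integral_mul_fderiv_eq_neg_fderiv_mul_of_integrable
    (μ := (volume : Measure (EuclideanSpace ℝ (Fin n)))) (f := f)
    (g := fun y => Real.exp (-V y)) (v := EuclideanSpace.single i 1)
    (Continuous.integrable_of_hasCompactSupport
      (cf.mul (by fun_prop)) (hfc.partialDeriv i).mul_right)
    (by
      simp only [hexp]
      exact Continuous.integrable_of_hasCompactSupport (by fun_prop) hfc.mul_right)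
    (Continuous.integrable_of_hasCompactSupport (by fun_prop) hfc.mul_right)
    (fun x _ => hf.differentiable (by norm_num) x)
    (fun x _ => (hVd x).neg.exp)
  rw [integral_withDensity_exp_neg cV0 hμ, integral_withDensity_exp_neg cV0 hμ,
    ← neg_inj]
  refine key.symm.trans ?_
  rw [← integral_neg]
  refine integral_congr_ae (.of_forall fun x => ?_)
  simp only [hexp]
  ring

/-- Integration by parts: `∫ (L_μ f) g dμ = -∫ ⟨∇f, ∇g⟩ dμ`. -/
theorem integral_Lmu_mul [IsFiniteMeasureOnCompacts μ] (hV : ContDiff ℝ 1 V)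
    (hμ : μ = volume.withDensity (fun x => ENNReal.ofReal (Real.exp (-V x))))
    (hf : ContDiff ℝ 2 f) (hfc : HasCompactSupport f) (hg : ContDiff ℝ 1 g) :
    ∫ x, Lmu V f x * g x ∂μ = -∫ x, ∑ i, partialDeriv i f x * partialDeriv i g x ∂μ := by
  have cg := hg.continuous
  have df (i : Fin n) : ContDiff ℝ 1 (partialDeriv i f) := hf.partialDeriv (by norm_num) i
  have cf (i : Fin n) := (df i).continuous
  have cff (i : Fin n) : Continuous (partialDeriv i (partialDeriv i f)) :=
    ((df i).partialDeriv (m := 0) (by norm_num) i).continuous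
  have cV (i : Fin n) : Continuous (partialDeriv i V) :=
    (hV.partialDeriv (m := 0) (by norm_num) i).continuous
  have cdg (i : Fin n) : Continuous (partialDeriv i g) :=
    (hg.partialDeriv (m := 0) (by norm_num) i).continuous
  have sf (i : Fin n) := hfc.partialDeriv i
  have sff (i : Fin n) := (sf i).partialDeriv i
  have I1 (i : Fin n) : Integrable
      (fun x => partialDeriv i (partialDeriv i f) x * g x) μ :=
    ((cff i).mul cg).integrable_of_hasCompactSupport (sff i).mul_right
  have I2 (i : Fin n) : Integrable
      (fun x => partialDeriv i f x * g x * partialDeriv i V x) μ :=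
    (((cf i).mul cg).mul (cV i)).integrable_of_hasCompactSupport
      ((sf i).mul_right (f' := g)).mul_right
  have I3 (i : Fin n) : Integrable (fun x => partialDeriv i f x * partialDeriv i g x) μ :=
    ((cf i).mul (cdg i)).integrable_of_hasCompactSupport (sf i).mul_right
  have I12 (i : Fin n) : Integrable (fun x => partialDeriv i (partialDeriv i f) x * g x
      - partialDeriv i f x * g x * partialDeriv i V x) μ := (I1 i).sub (I2 i)
  have key (i : Fin n) :
      ∫ x, (partialDeriv i (partialDeriv i f) x * g x
          - partialDeriv i f x * g x * partialDeriv i V x) ∂μ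
        = -∫ x, partialDeriv i f x * partialDeriv i g x ∂μ := by
    have h := integral_partialDeriv_eq hV hμ ((df i).mul hg) ((sf i).mul_right (f' := g)) i
    simp only [partialDeriv_mul ((df i).differentiable (by norm_num))
      (hg.differentiable (by norm_num))] at h
    rw [integral_add (I1 i) (I3 i)] at h
    rw [integral_sub (I1 i) (I2 i)]
    linarith
  rw [integral_finsetSum _ fun i _ => I3 i, ← Finset.sum_neg_distrib]
  simp only [← key]
  rw [← integral_finsetSum _ fun i _ => I12 i]
  refine integral_congr_ae (.of_forall fun x => ?_)
  simp only [Lmu_eq_sum, Finset.sum_mul]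
  refine Finset.sum_congr rfl fun i _ => ?_
  ring

/-- The Bochner formula `∫ (L_μ f)² dμ = ∫ ‖∇²f‖_F² dμ + ∫ ∇²V(∇f, ∇f) dμ`. -/
theorem integral_Lmu_sq [IsFiniteMeasureOnCompacts μ] (hV : ContDiff ℝ 2 V)
    (hμ : μ = volume.withDensity (fun x => ENNReal.ofReal (Real.exp (-V x))))
    (hf : ContDiff ℝ 3 f) (hfc : HasCompactSupport f) :
    ∫ x, Lmu V f x ^ 2 ∂μ = ∫ x, hessFrobSq f x ∂μ
      + ∫ x, ⟪fderiv ℝ (gradient V) x (gradient f x), gradient f x⟫ ∂μ := by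
  have hV1 : ContDiff ℝ 1 V := hV.of_le (by norm_num)
  have df (i : Fin n) : ContDiff ℝ 2 (partialDeriv i f) := hf.partialDeriv (by norm_num) i
  have cf (i : Fin n) := (df i).continuous
  have sf (i : Fin n) := hfc.partialDeriv i
  have cVV (i j : Fin n) : Continuous (partialDeriv i (partialDeriv j V)) :=
    ((hV.partialDeriv (m := 1) (by norm_num) j).partialDeriv (m := 0) (by norm_num) i).continuous
  have cff (i j : Fin n) : Continuous (partialDeriv i (partialDeriv j f)) :=
    ((df j).partialDeriv (m := 1) (by norm_num) i).continuous
  have cL (i : Fin n) : Continuous (Lmu V (partialDeriv i f)) := by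
    rw [funext (Lmu_eq_sum V _)]
    have c1 (j : Fin n) : Continuous (partialDeriv j (partialDeriv j (partialDeriv i f))) :=
      (((df i).partialDeriv (m := 1) (by norm_num) j).partialDeriv
        (m := 0) (by norm_num) j).continuous
    have c2 (j : Fin n) : Continuous (partialDeriv j V) :=
      (hV.partialDeriv (m := 1) (by norm_num) j).continuous
    fun_prop
  have I1 (i : Fin n) : Integrable (fun x => Lmu V (partialDeriv i f) x * partialDeriv i f x) μ :=
    ((cL i).mul (cf i)).integrable_of_hasCompactSupport (sf i).mul_left
  have I2 (i : Fin n) : Integrable (fun x => ∑ j, partialDeriv i f x * partialDeriv j f x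
      * partialDeriv i (partialDeriv j V) x) μ := by
    refine integrable_finsetSum _ fun j _ => Continuous.integrable_of_hasCompactSupport
      (((cf i).mul (cf j)).mul (cVV i j)) ?_
    exact ((sf i).mul_right (f' := partialDeriv j f)).mul_right
  have I3 (i : Fin n) : Integrable (fun x => ∑ j, partialDeriv i (partialDeriv j f) x ^ 2) μ := by
    refine integrable_finsetSum _ fun j _ => Continuous.integrable_of_hasCompactSupport
      ((cff i j).pow 2) ((sf j).partialDeriv i).fun_sq
  have hsq : ∫ x, Lmu V f x ^ 2 ∂μ = -∫ x, ∑ i, (Lmu V (partialDeriv i f) x * partialDeriv i f x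
      - ∑ j, partialDeriv i f x * partialDeriv j f x * partialDeriv i (partialDeriv j V) x) ∂μ := by
    simp only [pow_two]
    rw [integral_Lmu_mul hV1 hμ (hf.of_le (by norm_num)) hfc (contDiff_Lmu hV hf)]
    congr 2
    funext x
    refine Finset.sum_congr rfl fun i _ => ?_
    rw [partialDeriv_Lmu hV hf, mul_sub, Finset.mul_sum]
    congr 1
    · ring
    · exact Finset.sum_congr rfl fun j _ => by ring
  have I12 (i : Fin n) : Integrable (fun x => Lmu V (partialDeriv i f) x * partialDeriv i f x
      - ∑ j, partialDeriv i f x * partialDeriv j f x * partialDeriv i (partialDeriv j V) x) μ :=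
    (I1 i).sub (I2 i)
  have hhess : ∫ x, hessFrobSq f x ∂μ
      = ∑ i, ∫ x, ∑ j, partialDeriv i (partialDeriv j f) x ^ 2 ∂μ :=
    integral_finsetSum _ fun i _ => I3 i
  simp only [inner_fderiv_gradient hV, gradient_apply]
  rw [hsq, hhess, integral_finsetSum _ fun i _ => I12 i,
    integral_finsetSum _ fun i _ => I2 i, ← Finset.sum_add_distrib, ← Finset.sum_neg_distrib]
  refine Finset.sum_congr rfl fun i _ => ?_
  rw [integral_sub (I1 i) (I2 i), integral_Lmu_mul hV1 hμ (df i) (sf i) ((df i).of_le (by norm_num))]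
  simp only [partialDeriv_comm (hf.of_le (by norm_num)) i, pow_two]
  ring

/-- The spectral inequality `∫ |∇f|² dμ ≤ C_P ∫ (L_μ f)² dμ`, for a function whose variance is
at most `C_P ∫ |∇f|² dμ`. -/
theorem integral_norm_gradient_sq_le [IsProbabilityMeasure μ] {CP : ℝ} (hV : ContDiff ℝ 2 V)
    (hμ : μ = volume.withDensity (fun x => ENNReal.ofReal (Real.exp (-V x))))
    (hf : ContDiff ℝ 3 f) (hfc : HasCompactSupport f)
    (hP : (∫ x, (f x) ^ 2 ∂μ) - (∫ x, f x ∂μ) ^ 2 ≤ CP * ∫ x, ‖gradient f x‖ ^ 2 ∂μ) :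
    ∫ x, ‖gradient f x‖ ^ 2 ∂μ ≤ CP * ∫ x, Lmu V f x ^ 2 ∂μ := by
  have hV1 : ContDiff ℝ 1 V := hV.of_le (by norm_num)
  have hf2 : ContDiff ℝ 2 f := hf.of_le (by norm_num)
  have cf := hf.continuous
  have cL := (contDiff_Lmu hV hf).continuous
  have sL : HasCompactSupport (Lmu V f) := hfc.Lmu V
  have cdf (i : Fin n) : Continuous (partialDeriv i f) :=
    (hf.partialDeriv (m := 2) (by norm_num) i).continuous
  have hLf : ∫ x, Lmu V f x * f x ∂μ = -∫ x, ‖gradient f x‖ ^ 2 ∂μ := by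
    rw [integral_Lmu_mul hV1 hμ hf2 hfc (hf.of_le (by norm_num))]
    simp only [norm_gradient_sq]
    simp only [pow_two]
  have hL : ∫ x, Lmu V f x ∂μ = 0 := by
    simpa [partialDeriv] using
      integral_Lmu_mul (g := fun _ => 1) hV1 hμ hf2 hfc contDiff_const
  have hA0 : 0 ≤ ∫ x, ‖gradient f x‖ ^ 2 ∂μ := integral_nonneg fun x => by positivity
  rcases hA0.eq_or_lt with hA | hA
  · have := isOpenPosMeasure_withDensity_exp_neg hV.continuous hμ
    have hzero (x : EuclideanSpace ℝ (Fin n)) : ∑ i, partialDeriv i f x ^ 2 = 0 := by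
      by_contra hx
      have hpos := Continuous.integral_pos_of_hasCompactSupport_nonneg_nonzero (μ := μ)
        (f := fun x => ∑ i, partialDeriv i f x ^ 2) (by fun_prop)
        (HasCompactSupport.fun_sum _ fun i => (hfc.partialDeriv i).fun_sq)
        (fun x => Finset.sum_nonneg fun i _ => sq_nonneg _) hx
      simp only [norm_gradient_sq] at hA
      exact hpos.ne hA
    have hd (i : Fin n) : partialDeriv i f = fun _ => 0 := by
      funext x
      have := (Finset.sum_eq_zero_iff_of_nonneg fun i _ => sq_nonneg _).1 (hzero x) i
        (Finset.mem_univ i)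
      exact pow_eq_zero_iff two_ne_zero |>.1 this
    have hLz (x : EuclideanSpace ℝ (Fin n)) : Lmu V f x = 0 := by
      simp only [Lmu_eq_sum, hd]
      simp [partialDeriv]
    simp [← hA, hLz]
  · set A := ∫ x, ‖gradient f x‖ ^ 2 ∂μ
    set B := ∫ x, Lmu V f x ^ 2 ∂μ
    set m := ∫ x, f x ∂μ with hm
    have If : Integrable f μ := cf.integrable_of_hasCompactSupport hfc
    have If2 : Integrable (fun x => f x ^ 2) μ :=
      (cf.pow 2).integrable_of_hasCompactSupport hfc.fun_sq
    have IL : Integrable (Lmu V f) μ := cL.integrable_of_hasCompactSupport sL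
    have IL2 : Integrable (fun x => Lmu V f x ^ 2) μ :=
      (cL.pow 2).integrable_of_hasCompactSupport sL.fun_sq
    have ILf : Integrable (fun x => Lmu V f x * f x) μ :=
      (cL.mul cf).integrable_of_hasCompactSupport hfc.mul_left
    have hquad (s : ℝ) : 0 ≤ B * (s * s) + (-2 * A) * s + CP * A := by
      have h0 : 0 ≤ ∫ x, (f x - m + s * Lmu V f x) ^ 2 ∂μ :=
        integral_nonneg fun x => sq_nonneg _
      have hexpand : ∫ x, (f x - m + s * Lmu V f x) ^ 2 ∂μ
          = ∫ x, ((f x ^ 2 - 2 * m * f x + m ^ 2)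
            + (s ^ 2 * Lmu V f x ^ 2 + 2 * s * (Lmu V f x * f x) - 2 * m * s * Lmu V f x)) ∂μ := by
        refine integral_congr_ae (.of_forall fun x => ?_)
        ring
      have J1 : Integrable (fun x => f x ^ 2 - 2 * m * f x) μ := If2.sub (If.const_mul _)
      have J2 : Integrable (fun x => s ^ 2 * Lmu V f x ^ 2 + 2 * s * (Lmu V f x * f x)) μ :=
        (IL2.const_mul _).add (ILf.const_mul _)
      have J3 : Integrable (fun x => f x ^ 2 - 2 * m * f x + m ^ 2) μ :=
        J1.add (integrable_const _)
      have J4 : Integrable (fun x => s ^ 2 * Lmu V f x ^ 2 + 2 * s * (Lmu V f x * f x)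
          - 2 * m * s * Lmu V f x) μ := J2.sub (IL.const_mul _)
      rw [hexpand, integral_add J3 J4, integral_add J1 (integrable_const _),
        integral_sub If2 (If.const_mul _), integral_sub J2 (IL.const_mul _),
        integral_add (IL2.const_mul _) (ILf.const_mul _)] at h0
      simp only [integral_const_mul, integral_const, hL, hLf, ← hm, probReal_univ, smul_eq_mul] at h0
      linarith
    have hdisc := discrim_le_zero hquad
    rw [discrim] at hdisc
    nlinarith

end WeightedIntegrals

/-- Under Poincaré with constant `C_P` and `κ`-semi-convexity of `V`,
`∫ ‖∇²f‖_F² dμ ≤ (1 + κ C_P) ∫ (L_μ f)² dμ`. -/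
theorem hessian_L2_bound
    (n : ℕ) (V : EuclideanSpace ℝ (Fin n) → ℝ) (κ CP : ℝ) (hκ : 0 ≤ κ)
    (hV : ContDiff ℝ 2 V)
    (μ : Measure (EuclideanSpace ℝ (Fin n)))
    (hμ : μ = volume.withDensity (fun x => ENNReal.ofReal (Real.exp (-V x))))
    [IsProbabilityMeasure μ]
    (hsemi : ∀ x v : EuclideanSpace ℝ (Fin n),
      -(κ * ‖v‖ ^ 2) ≤ ⟪fderiv ℝ (gradient V) x v, v⟫)
    (hPoincare : ∀ f : EuclideanSpace ℝ (Fin n) → ℝ,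
      ContDiff ℝ (⊤ : ℕ∞) f → HasCompactSupport f →
      (∫ x, (f x) ^ 2 ∂μ) - (∫ x, f x ∂μ) ^ 2 ≤ CP * ∫ x, ‖gradient f x‖ ^ 2 ∂μ) :
    ∀ f : EuclideanSpace ℝ (Fin n) → ℝ, ContDiff ℝ (⊤ : ℕ∞) f → HasCompactSupport f →
      ∫ x, hessFrobSq f x ∂μ ≤ (1 + κ * CP) * ∫ x, (Lmu V f x) ^ 2 ∂μ := by
  intro f hf hfc
  have hf3 : ContDiff ℝ 3 f := hf.of_le (WithTop.coe_le_coe.2 (le_top : (3 : ℕ∞) ≤ ⊤))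
  have hbochner := integral_Lmu_sq hV hμ hf3 hfc
  have hspec := integral_norm_gradient_sq_le hV hμ hf3 hfc (hPoincare f hf hfc)
  have cdf (i : Fin n) : Continuous (partialDeriv i f) :=
    (hf3.partialDeriv (m := 2) (by norm_num) i).continuous
  have cVV (i j : Fin n) : Continuous (partialDeriv i (partialDeriv j V)) :=
    ((hV.partialDeriv (m := 1) (by norm_num) j).partialDeriv (m := 0) (by norm_num) i).continuous
  have hgrad : Integrable (fun x => ‖gradient f x‖ ^ 2) μ := by
    simp only [norm_gradient_sq]
    refine Continuous.integrable_of_hasCompactSupport (by fun_prop)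
      (HasCompactSupport.fun_sum _ fun i => (hfc.partialDeriv i).fun_sq)
  have hhess : Integrable
      (fun x => ⟪fderiv ℝ (gradient V) x (gradient f x), gradient f x⟫) μ := by
    simp only [inner_fderiv_gradient hV, gradient_apply]
    refine Continuous.integrable_of_hasCompactSupport (by fun_prop)
      (HasCompactSupport.fun_sum _ fun i => HasCompactSupport.fun_sum _ fun j => ?_)
    exact ((hfc.partialDeriv i).mul_right (f' := partialDeriv j f)).mul_right
  have hlower : -(κ * ∫ x, ‖gradient f x‖ ^ 2 ∂μ)
      ≤ ∫ x, ⟪fderiv ℝ (gradient V) x (gradient f x), gradient f x⟫ ∂μ := by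
    rw [← integral_const_mul, ← integral_neg]
    exact integral_mono (hgrad.const_mul κ).neg hhess fun x => hsemi x _
  have := mul_le_mul_of_nonneg_left hspec hκ
  linarith
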